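/- arXiv:math/0002075 — 8 statements merged into one kernel-verified Lean document; each statement's English description precedes it below -/
import Mathlib

section
/- Let U ⊂ ℍ be a real subspace of dimension 2. Then there exist quaternions N, R with N² = −1 = R², N·U = U = U·R, and U = {x ∈ ℍ : N x R = x}. -/
/-- A quaternion commuting with a square root `R` of `-1` lies in the real span of `1` and `R`. -/
theorem Quaternion.exists_eq_smul_one_add_smul_of_commute {y R : Quaternion ℝ}
    (hR : R ^ 2 = -1) (h : R * y = y * R) :
    ∃ s t : ℝ, y = s • (1 : Quaternion ℝ) + t • R := by
  have hn : Quaternion.normSq R = 1 := by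
    have := congrArg Quaternion.normSq hR
    rw [map_pow, Quaternion.normSq_neg, map_one] at this
    nlinarith [Quaternion.normSq_nonneg (a := R)]
  have hre : R.re = 0 := by
    rw [← Quaternion.sq_eq_neg_normSq, hn, hR, Quaternion.coe_one]
  rw [Quaternion.normSq_def'] at hn
  have hI := congrArg (·.imI) h
  have hJ := congrArg (·.imJ) h
  have hK := congrArg (·.imK) h
  simp only [Quaternion.imI_mul, Quaternion.imJ_mul, Quaternion.imK_mul, hre] at hI hJ hK hn
  refine ⟨y.re, y.imI * R.imI + y.imJ * R.imJ + y.imK * R.imK, ?_⟩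
  ext <;> simp [hre]
  · linear_combination -y.imI * hn - (1 / 2) * R.imJ * hK + (1 / 2) * R.imK * hJ
  · linear_combination -y.imJ * hn - (1 / 2) * R.imK * hI + (1 / 2) * R.imI * hK
  · linear_combination -y.imK * hn - (1 / 2) * R.imI * hJ + (1 / 2) * R.imJ * hI

/-- A real plane in the quaternions is spanned by two orthogonal unit quaternions. -/
theorem Quaternion.exists_orthonormal_span_pair (U : Submodule ℝ (Quaternion ℝ))
    (hU : Module.finrank ℝ U = 2) :
    ∃ a b : Quaternion ℝ, a * star a = 1 ∧ b * star b = 1 ∧ b * star a = -(a * star b) ∧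
      U = Submodule.span ℝ {a, b} := by
  let e := (stdOrthonormalBasis ℝ U).reindex (finCongr hU)
  have unit (i : Fin 2) : (e i : Quaternion ℝ) * star (e i : Quaternion ℝ) = 1 := by
    have h : ‖(e i : Quaternion ℝ)‖ = 1 := e.norm_eq_one i
    rw [Quaternion.self_mul_star, Quaternion.normSq_eq_norm_mul_self, h]
    simp
  refine ⟨e 0, e 1, unit 0, unit 1, ?_, ?_⟩
  · have h : inner ℝ (e 0 : Quaternion ℝ) (e 1 : Quaternion ℝ) = 0 :=
      e.inner_eq_zero (by decide)
    rw [Quaternion.inner_def, ← Quaternion.star_eq_neg, star_mul, star_star] at h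
    exact h
  · have h := congrArg (Submodule.map U.subtype) e.toBasis.span_eq
    rw [Submodule.map_span, Submodule.map_top, Submodule.range_subtype] at h
    refine h.symm.trans ?_
    congr 1
    ext x
    simp [Fin.exists_fin_two, eq_comm]

/-- A map whose square is negation and which preserves a submodule maps it onto itself. -/
theorem Submodule.image_eq_of_apply_apply_eq_neg {K M : Type*} [Ring K] [AddCommGroup M]
    [Module K M] (U : Submodule K M) {f : M → M} (hf : ∀ x, f (f x) = -x)
    (hU : ∀ x ∈ U, f x ∈ U) : f '' (U : Set M) = U := by
  refine Set.Subset.antisymm (Set.image_subset_iff.2 hU) fun x hx => ?_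
  have h : f (f (f (f x))) = x := by rw [hf (f (f x)), hf, neg_neg]
  exact ⟨f (f (f x)), hU _ (hU _ (hU _ hx)), h⟩

/-- For every 2-dimensional real subspace `U ⊂ ℍ` there exist quaternions `N`, `R`
with `N² = -1 = R²`, `N·U = U = U·R`, and `U = {x | N x R = x}`. -/
theorem exists_left_right_normal (U : Submodule ℝ (Quaternion ℝ))
    (hU : Module.finrank ℝ U = 2) :
    ∃ N R : Quaternion ℝ, N ^ 2 = -1 ∧ R ^ 2 = -1 ∧
      (N * ·) '' (U : Set (Quaternion ℝ)) = (U : Set (Quaternion ℝ)) ∧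
      (· * R) '' (U : Set (Quaternion ℝ)) = (U : Set (Quaternion ℝ)) ∧
      (U : Set (Quaternion ℝ)) = {x : Quaternion ℝ | N * x * R = x} := by
  obtain ⟨a, b, ha, hb, hab, rfl⟩ := Quaternion.exists_orthonormal_span_pair U hU
  have ha' : star a * a = 1 := by rw [star_comm_self', ha]
  have hb' : star b * b = 1 := by rw [star_comm_self', hb]
  obtain ⟨N, hN⟩ : ∃ N, N = b * star a := ⟨_, rfl⟩
  obtain ⟨R, hR⟩ : ∃ R, R = -(star a * b) := ⟨_, rfl⟩
  have hNa : N * a = b := by rw [hN, mul_assoc, ha', mul_one]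
  have hNb : N * b = -a := by rw [hN, hab, neg_mul, mul_assoc, hb', mul_one]
  have haR : a * R = -b := by rw [hR, mul_neg, ← mul_assoc, ha, one_mul]
  have hbR : b * R = a := by rw [hR, mul_neg, ← mul_assoc, ← hN, hNb, neg_neg]
  have hN2 : N ^ 2 = -1 := by
    rw [sq]
    nth_rw 2 [hN]
    rw [← mul_assoc, hNb, neg_mul, ha]
  have hR2 : R ^ 2 = -1 := by
    rw [sq]
    nth_rw 1 [hR]
    rw [neg_mul, mul_assoc, hbR, ha']
  refine ⟨N, R, hN2, hR2, ?_, ?_, ?_⟩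
  · refine Submodule.image_eq_of_apply_apply_eq_neg _ (fun x => ?_) fun x hx => ?_
    · rw [← mul_assoc, ← sq, hN2, neg_one_mul]
    · obtain ⟨s, t, rfl⟩ := Submodule.mem_span_pair.1 hx
      refine Submodule.mem_span_pair.2 ⟨-t, s, ?_⟩
      rw [mul_add, mul_smul_comm, mul_smul_comm, hNa, hNb]
      module
  · refine Submodule.image_eq_of_apply_apply_eq_neg _ (fun x => ?_) fun x hx => ?_
    · rw [mul_assoc, ← sq, hR2, mul_neg_one]
    · obtain ⟨s, t, rfl⟩ := Submodule.mem_span_pair.1 hx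
      refine Submodule.mem_span_pair.2 ⟨t, -s, ?_⟩
      rw [add_mul, smul_mul_assoc, smul_mul_assoc, haR, hbR]
      module
  · ext x
    rw [SetLike.mem_coe, Set.mem_ofPred_eq]
    constructor
    · intro hx
      obtain ⟨s, t, rfl⟩ := Submodule.mem_span_pair.1 hx
      simp only [mul_add, add_mul, mul_smul_comm, smul_mul_assoc, hNa, hNb, neg_mul, haR, hbR,
        neg_neg]
    · intro hx
      have hRa : R * star a = -(star a * N) := by rw [hR, hN, neg_mul, mul_assoc]
      have hcomm : R * (star a * x) = (star a * x) * R := by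
        have hNx : N * x = -(x * R) :=
          calc N * x = -(N * x * R * R) := by rw [mul_assoc _ R, ← sq, hR2, mul_neg_one, neg_neg]
            _ = -(x * R) := by rw [hx]
        rw [← mul_assoc, hRa, neg_mul, mul_assoc, hNx, mul_neg, neg_neg, mul_assoc]
      obtain ⟨s, t, hst⟩ := Quaternion.exists_eq_smul_one_add_smul_of_commute hR2 hcomm
      refine Submodule.mem_span_pair.2 ⟨s, -t, ?_⟩
      have h := congrArg (a * ·) hst
      simp only [← mul_assoc, ha, one_mul, mul_add, mul_smul_comm, mul_one, haR] at h
      rw [h]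
      module
end

section
/- Let U ⊂ ℍ be a real subspace of dimension 2, and suppose both pairs (N, R) and (N', R') of quaternions satisfy N² = −1 = R², N·U = U = U·R, U = {x ∈ ℍ : N x R = x} (and likewise for (N', R')). Then (N', R') = (N, R) or (N', R') = (−N, −R). -/
/-- A quaternion whose square is `-1` is purely imaginary. -/
theorem Quaternion.re_eq_zero_of_sq_eq_neg_one {N : Quaternion ℝ} (hN : N ^ 2 = -1) :
    N.re = 0 := by
  rw [Quaternion.ext_iff] at hN
  simp only [sq, Quaternion.re_mul, Quaternion.imI_mul, Quaternion.imJ_mul, Quaternion.imK_mul,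
    Quaternion.re_neg, Quaternion.imI_neg, Quaternion.imJ_neg, Quaternion.imK_neg,
    Quaternion.re_one, Quaternion.imI_one, Quaternion.imJ_one, Quaternion.imK_one] at hN
  obtain ⟨h0, h1, h2, h3⟩ := hN
  by_contra h
  have hI : N.imI = 0 := mul_left_cancel₀ h (by linarith)
  have hJ : N.imJ = 0 := mul_left_cancel₀ h (by linarith)
  have hK : N.imK = 0 := mul_left_cancel₀ h (by linarith)
  rw [hI, hJ, hK] at h0
  nlinarith [sq_nonneg N.re]

/-- A square root of `-1` in the real span of `1` and another one `N` is `N` or `-N`. -/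
theorem Quaternion.eq_or_eq_neg_of_sq_eq_neg_one {N N' : Quaternion ℝ} (hN : N ^ 2 = -1)
    (hN' : N' ^ 2 = -1) {a b : ℝ} (h : N' = a • 1 + b • N) : N' = N ∨ N' = -N := by
  have ha : a = 0 := by
    have := congrArg (fun q : Quaternion ℝ => q.re) h
    simpa [re_eq_zero_of_sq_eq_neg_one hN, re_eq_zero_of_sq_eq_neg_one hN'] using this.symm
  obtain rfl : N' = b • N := by simpa [ha] using h
  have hb : b ^ 2 = 1 := by
    rw [smul_pow, hN] at hN'
    simpa using congrArg (fun q : Quaternion ℝ => q.re) hN'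
  rcases sq_eq_sq_iff_eq_or_eq_neg.mp (hb.trans (one_pow 2).symm) with rfl | rfl <;> simp

/-- In a 2-dimensional space stable under left multiplication by a square root `N` of `-1`,
every vector is a combination of `u` and `N * u`, for any nonzero `u`. -/
theorem Quaternion.exists_eq_smul_add_smul_mul {U : Submodule ℝ (Quaternion ℝ)}
    (hU : Module.finrank ℝ U = 2) {N u v : Quaternion ℝ} (hN : N ^ 2 = -1) (hu : u ∈ U)
    (hu0 : u ≠ 0) (hNu : N * u ∈ U) (hv : v ∈ U) : ∃ a b : ℝ, a • u + b • (N * u) = v := by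
  have hli : LinearIndependent ℝ ![(⟨u, hu⟩ : U), ⟨N * u, hNu⟩] := by
    rw [LinearIndependent.pair_iff]
    intro s t hst
    have h : (s • 1 + t • N) * u = 0 := by
      simpa [add_mul] using congrArg Subtype.val hst
    have h' := (mul_eq_zero.mp h).resolve_right hu0
    have hs : s = 0 := by
      simpa [re_eq_zero_of_sq_eq_neg_one hN] using congrArg (fun q : Quaternion ℝ => q.re) h'
    have hN0 : N ≠ 0 := by
      rintro rfl
      simp at hN
    exact ⟨hs, by simpa [hs, hN0] using h'⟩
  have hspan := hli.span_eq_top_of_card_eq_finrank' (by simp [hU])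
  have hmem : (⟨v, hv⟩ : U) ∈ Submodule.span ℝ (Set.range ![(⟨u, hu⟩ : U), ⟨N * u, hNu⟩]) :=
    hspan ▸ Submodule.mem_top
  rw [Matrix.range_cons_cons_empty, Submodule.mem_span_pair] at hmem
  obtain ⟨a, b, h⟩ := hmem
  exact ⟨a, b, by simpa using congrArg Subtype.val h⟩


/-- The pair `(N, R)` associated to a 2-dimensional real subspace `U ⊂ ℍ` (with
`N² = -1 = R²`, `N·U = U = U·R`, `U = {x | N x R = x}`) is unique up to sign. -/
theorem left_right_normal_unique_up_to_sign (U : Submodule ℝ (Quaternion ℝ))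
    (hU : Module.finrank ℝ U = 2)
    (N R N' R' : Quaternion ℝ)
    (hN : N ^ 2 = -1) (hR : R ^ 2 = -1)
    (hNU : (N * ·) '' (U : Set (Quaternion ℝ)) = (U : Set (Quaternion ℝ)))
    (hUR : (· * R) '' (U : Set (Quaternion ℝ)) = (U : Set (Quaternion ℝ)))
    (hfix : (U : Set (Quaternion ℝ)) = {x : Quaternion ℝ | N * x * R = x})
    (hN' : N' ^ 2 = -1) (hR' : R' ^ 2 = -1)
    (hNU' : (N' * ·) '' (U : Set (Quaternion ℝ)) = (U : Set (Quaternion ℝ)))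
    (hUR' : (· * R') '' (U : Set (Quaternion ℝ)) = (U : Set (Quaternion ℝ)))
    (hfix' : (U : Set (Quaternion ℝ)) = {x : Quaternion ℝ | N' * x * R' = x}) :
    (N' = N ∧ R' = R) ∨ (N' = -N ∧ R' = -R) := by
  obtain ⟨u, hu, hu0⟩ : ∃ u ∈ U, u ≠ 0 := U.exists_mem_ne_zero_of_ne_bot <| by
    rintro rfl
    simp at hU
  have hNu : N * u ∈ U := hNU.subset (Set.mem_image_of_mem _ hu)
  have hNu' : N' * u ∈ U := hNU'.subset (Set.mem_image_of_mem _ hu)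
  obtain ⟨a, b, hab⟩ := Quaternion.exists_eq_smul_add_smul_mul hU hN hu hu0 hNu hNu'
  have hN'N : N' = a • 1 + b • N :=
    mul_right_cancel₀ hu0 (by rw [← hab]; simp [add_mul])
  have hfu : N * u * R = u := hfix.subset hu
  have hfu' : N' * u * R' = u := hfix'.subset hu
  have hN0 : N ≠ 0 := by
    rintro rfl
    simp at hN
  rcases Quaternion.eq_or_eq_neg_of_sq_eq_neg_one hN hN' hN'N with rfl | rfl
  · exact .inl ⟨rfl, mul_left_cancel₀ (mul_ne_zero hN0 hu0) (hfu'.trans hfu.symm)⟩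
  · refine .inr ⟨rfl, mul_left_cancel₀ (mul_ne_zero hN0 hu0) ?_⟩
    rw [mul_neg, hfu, ← neg_eq_iff_eq_neg, ← neg_mul, ← neg_mul, hfu']
end

section
/- Given quaternions N, R with N² = −1 = R², the sets U = {x ∈ ℍ : N x R = x} and U⊥ = {x ∈ ℍ : N x R = −x} are real subspaces of ℍ, each of real dimension 2; they are orthogonal to each other with respect to the Euclidean inner product, and ℍ = U ⊕ U⊥. -/
theorem Quaternion.star_mul_self_of_sq_eq_neg_one {N : Quaternion ℝ} (hN : N ^ 2 = -1) :
    star N * N = 1 := by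
  have h : ‖N‖ ^ 2 = 1 := by rw [← norm_pow, hN, norm_neg, norm_one]
  rw [Quaternion.star_mul_self, Quaternion.normSq_eq_norm_mul_self, ← sq, h, Quaternion.coe_one]

theorem Quaternion.re_mul_comm (a b : Quaternion ℝ) : (a * b).re = (b * a).re := by
  simp only [Quaternion.re_mul]
  ring

/-- A square root of `-1` is not central, so its commutator with a suitable quaternion is a
nonzero element anticommuting with it. -/
theorem Quaternion.exists_anticommute {N : Quaternion ℝ} (hN : N ^ 2 = -1) :
    ∃ p : Quaternion ℝ, p ≠ 0 ∧ N * p = -(p * N) := by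
  have key (q : Quaternion ℝ) : N * (N * q - q * N) = -((N * q - q * N) * N) := by
    calc N * (N * q - q * N) = N ^ 2 * q - N * q * N := by noncomm_ring
      _ = q * N ^ 2 - N * q * N := by simp [hN]
      _ = -((N * q - q * N) * N) := by noncomm_ring
  by_contra! h
  have comm (q : Quaternion ℝ) : N * q = q * N := by
    by_contra hq
    exact h _ (sub_ne_zero.2 hq) (key q)
  have hJ (q : Quaternion ℝ) := congrArg QuaternionAlgebra.imJ (comm q)
  have hK (q : Quaternion ℝ) := congrArg QuaternionAlgebra.imK (comm q)
  have hre := congrArg QuaternionAlgebra.re hN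
  rw [sq] at hre
  simp only [Quaternion.imJ_mul, Quaternion.imK_mul] at hJ hK
  simp only [Quaternion.re_mul, Quaternion.re_neg, Quaternion.re_one] at hre
  have h1 : N.imI = 0 := by linarith [hK ⟨0, 0, 1, 0⟩]
  have h2 : N.imJ = 0 := by linarith [hK ⟨0, 1, 0, 0⟩]
  have h3 : N.imK = 0 := by linarith [hJ ⟨0, 1, 0, 0⟩]
  rw [h1, h2, h3] at hre
  nlinarith [sq_nonneg N.re]

/-- Left multiplication by a nonzero `p` embeds one subspace into another that contains its
image. -/
theorem Quaternion.finrank_le_of_mul_mem {V W : Submodule ℝ (Quaternion ℝ)} {p : Quaternion ℝ}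
    (hp : p ≠ 0) (h : ∀ x ∈ V, p * x ∈ W) : Module.finrank ℝ V ≤ Module.finrank ℝ W := by
  refine LinearMap.finrank_le_finrank_of_injective
    (f := (LinearMap.mulLeft ℝ p).restrict (p := V) (q := W) h) fun x y hxy => ?_
  exact Subtype.ext (mul_left_cancel₀ hp (congrArg Subtype.val hxy))

/-- Given quaternions `N`, `R` with `N² = -1 = R²`, the sets `{x | N x R = x}` and
`{x | N x R = -x}` are real subspaces of `ℍ` of dimension 2; they are mutually
orthogonal for the Euclidean inner product `⟨a, b⟩ = Re (conj a · b)` and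
`ℍ = U ⊕ U⊥`. -/
theorem eigenspaces_of_NxR (N R : Quaternion ℝ) (hN : N ^ 2 = -1) (hR : R ^ 2 = -1) :
    ∃ U Uperp : Submodule ℝ (Quaternion ℝ),
      (U : Set (Quaternion ℝ)) = {x : Quaternion ℝ | N * x * R = x} ∧
      (Uperp : Set (Quaternion ℝ)) = {x : Quaternion ℝ | N * x * R = -x} ∧
      Module.finrank ℝ U = 2 ∧ Module.finrank ℝ Uperp = 2 ∧
      (∀ x ∈ U, ∀ y ∈ Uperp, (star x * y).re = 0) ∧
      IsCompl U Uperp := by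
  let f : Quaternion ℝ →ₗ[ℝ] Quaternion ℝ := LinearMap.mulLeftRight ℝ (N, R)
  have hf (x : Quaternion ℝ) : f x = N * x * R := LinearMap.mulLeftRight_apply ..
  let U := LinearMap.ker (f - LinearMap.id)
  let W := LinearMap.ker (f + LinearMap.id)
  have hU (x : Quaternion ℝ) : x ∈ U ↔ N * x * R = x := by
    simp [U, hf, sub_eq_zero]
  have hW (x : Quaternion ℝ) : x ∈ W ↔ N * x * R = -x := by
    simp [W, hf, add_eq_zero_iff_eq_neg]
  have hinv (x : Quaternion ℝ) : N * (N * x * R) * R = x := by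
    calc N * (N * x * R) * R = N ^ 2 * x * R ^ 2 := by noncomm_ring
      _ = x := by simp [hN, hR]
  have hcompl : IsCompl U W := by
    refine ⟨Submodule.disjoint_def.2 fun x hx hx' => ?_,
      codisjoint_iff.2 (Submodule.eq_top_iff'.2 fun x => ?_)⟩
    · have hneg : x = -x := ((hU x).1 hx).symm.trans ((hW x).1 hx')
      calc x = (2⁻¹ : ℝ) • (x - -x) := by module
        _ = 0 := by rw [← hneg, sub_self, smul_zero]
    · refine Submodule.mem_sup.2 ⟨(2⁻¹ : ℝ) • (x + N * x * R), U.smul_mem _ ?_,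
        (2⁻¹ : ℝ) • (x - N * x * R), W.smul_mem _ ?_, by module⟩
      · rw [hU, mul_add, add_mul, hinv, add_comm]
      · rw [hW, mul_sub, sub_mul, hinv, neg_sub]
  obtain ⟨p, hp, hNp⟩ := Quaternion.exists_anticommute hN
  have hswap (x : Quaternion ℝ) : N * (p * x) * R = -(p * (N * x * R)) := by
    rw [← mul_assoc N, hNp]
    noncomm_ring
  have hle : Module.finrank ℝ U ≤ Module.finrank ℝ W :=
    Quaternion.finrank_le_of_mul_mem hp fun x hx => by rw [hW, hswap, (hU x).1 hx]
  have hge : Module.finrank ℝ W ≤ Module.finrank ℝ U :=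
    Quaternion.finrank_le_of_mul_mem hp fun x hx => by rw [hU, hswap, (hW x).1 hx]; simp
  have hsum := Submodule.finrank_add_eq_of_isCompl hcompl
  rw [Quaternion.finrank_eq_four] at hsum
  refine ⟨U, W, Set.ext hU, Set.ext hW, by lia, by lia, fun x hx y hy => ?_, hcompl⟩
  have hNN := Quaternion.star_mul_self_of_sq_eq_neg_one hN
  have hRR : R * star R = 1 := by
    rw [Quaternion.self_mul_star, ← Quaternion.star_mul_self,
      Quaternion.star_mul_self_of_sq_eq_neg_one hR]
  have h : (star x * y).re = -(star x * y).re := by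
    calc (star x * y).re = (star (N * x * R) * -(N * y * R)).re := by
          rw [(hU x).1 hx, (hW y).1 hy, neg_neg]
      _ = -(star R * (star x * (star N * N) * y * R)).re := by
          rw [← Quaternion.re_neg]
          simp only [star_mul, mul_neg, mul_assoc]
      _ = -(star x * y).re := by
          rw [hNN, mul_one, Quaternion.re_mul_comm, mul_assoc, hRR, mul_one]
  linarith
end

section
/- Let N, R ∈ ℍ satisfy N² = −1 = R². Then the kernel of the ℝ-linear map ℍ → ℍ, x ↦ N x + x R, equals {x ∈ ℍ : N x R = x} and has real dimension 2. Consequently, for any H ∈ ℍ the solution set of the equation N x + x R = H is either empty or a 2-dimensional real affine subspace of ℍ (a coset of this kernel). -/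
namespace Quaternion

/-- A real quaternion squaring to `-1` is purely imaginary. -/
lemma re_eq_zero_of_sq_eq_neg_one_s11 {N : Quaternion ℝ} (hN : N ^ 2 = -1) : N.re = 0 := by
  rw [pow_two] at hN
  have h0 := congrArg QuaternionAlgebra.re hN
  have h1 := congrArg QuaternionAlgebra.imI hN
  have h2 := congrArg QuaternionAlgebra.imJ hN
  have h3 := congrArg QuaternionAlgebra.imK hN
  simp only [re_mul, imI_mul, imJ_mul, imK_mul, re_neg, imI_neg, imJ_neg, imK_neg,
    re_one, imI_one, imJ_one, imK_one] at h0 h1 h2 h3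
  by_contra h
  have hI : N.imI = 0 := mul_left_cancel₀ h (by linarith)
  have hJ : N.imJ = 0 := mul_left_cancel₀ h (by linarith)
  have hK : N.imK = 0 := mul_left_cancel₀ h (by linarith)
  rw [hI, hJ, hK] at h0
  nlinarith [mul_self_nonneg N.re]

/-- The basis `1, i, j, k` of the real quaternions. -/
noncomputable def realBasisOneIJK : Module.Basis (Fin 4) ℝ (Quaternion ℝ) :=
  QuaternionAlgebra.basisOneIJK (-1) 0 (-1)

lemma realBasisOneIJK_repr (q : Quaternion ℝ) :
    ⇑(realBasisOneIJK.repr q) = ![q.re, q.imI, q.imJ, q.imK] :=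
  rfl

lemma realBasisOneIJK_apply (n : Fin 4) :
    realBasisOneIJK n = (equivTuple ℝ).symm (Pi.single n 1) :=
  congrFun (Module.Basis.coe_ofEquivFun (QuaternionAlgebra.linearEquivTuple (-1 : ℝ) 0 (-1))) n

/-- The trace of the two-sided multiplication `x ↦ a * x * b` on the real quaternions. -/
lemma trace_mulLeftRight (a b : Quaternion ℝ) :
    LinearMap.trace ℝ (Quaternion ℝ) (LinearMap.mulLeftRight ℝ (a, b)) = 4 * a.re * b.re := by
  rw [LinearMap.trace_eq_matrix_trace ℝ realBasisOneIJK, Matrix.trace, Fin.sum_univ_four]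
  simp only [Matrix.diag_apply, LinearMap.toMatrix_apply, realBasisOneIJK_repr,
    LinearMap.mulLeftRight_apply, re_mul, imI_mul, imJ_mul, imK_mul, realBasisOneIJK_apply]
  simp
  ring

end Quaternion

open Quaternion in
/-- For `N, R ∈ ℍ` with `N² = -1 = R²`, the kernel of `x ↦ N x + x R` equals
`{x | N x R = x}` and has real dimension 2; hence for any `H ∈ ℍ` the solution set
of `N x + x R = H` is empty or a coset of this 2-dimensional kernel. -/
theorem kernel_NxplusxR (N R : Quaternion ℝ) (hN : N ^ 2 = -1) (hR : R ^ 2 = -1) :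
    ∃ K : Submodule ℝ (Quaternion ℝ),
      (K : Set (Quaternion ℝ)) = {x : Quaternion ℝ | N * x + x * R = 0} ∧
      (K : Set (Quaternion ℝ)) = {x : Quaternion ℝ | N * x * R = x} ∧
      Module.finrank ℝ K = 2 ∧
      ∀ H : Quaternion ℝ,
        {x : Quaternion ℝ | N * x + x * R = H} = ∅ ∨
        ∃ x₀ : Quaternion ℝ, N * x₀ + x₀ * R = H ∧
          {x : Quaternion ℝ | N * x + x * R = H} =
            (fun y => x₀ + y) '' (K : Set (Quaternion ℝ)) := by
  have hNN : N * N = -1 := by rw [← pow_two, hN]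
  have hRR : R * R = -1 := by rw [← pow_two, hR]
  have hφφ (x : Quaternion ℝ) : N * (N * x * R) * R = x := by
    rw [show N * (N * x * R) * R = (N * N) * x * (R * R) by noncomm_ring, hNN, hRR]
    simp
  let T : Quaternion ℝ →ₗ[ℝ] Quaternion ℝ := LinearMap.mulLeft ℝ N + LinearMap.mulRight ℝ R
  let φ : Quaternion ℝ →ₗ[ℝ] Quaternion ℝ := LinearMap.mulLeftRight ℝ (N, R)
  have hT (x : Quaternion ℝ) : T x = N * x + x * R := rfl
  have hφ (x : Quaternion ℝ) : φ x = N * x * R := LinearMap.mulLeftRight_apply N R x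
  have hker (x : Quaternion ℝ) : x ∈ LinearMap.ker T ↔ N * x * R = x := by
    rw [LinearMap.mem_ker, hT]
    constructor
    · intro h
      have h' : N * N * x + N * x * R = 0 := by
        rw [mul_assoc N N x, mul_assoc N x R, ← mul_add, h, mul_zero]
      rw [hNN, neg_one_mul, neg_add_eq_zero] at h'
      exact h'.symm
    · intro h
      have h' : N * x = -(x * R) := by
        rw [← neg_eq_iff_eq_neg]
        calc -(N * x) = N * x * (R * R) := by rw [hRR, mul_neg_one]
          _ = x * R := by rw [← mul_assoc, h]
      rw [h', neg_add_cancel]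
  refine ⟨LinearMap.ker T, rfl, Set.ext hker, ?_, fun H => ?_⟩
  · have hproj : LinearMap.IsProj (LinearMap.ker T) ((2⁻¹ : ℝ) • (LinearMap.id + φ)) := by
      constructor
      · intro x
        rw [hker, LinearMap.smul_apply, LinearMap.add_apply, LinearMap.id_apply, hφ,
          mul_smul_comm, smul_mul_assoc, mul_add, add_mul, hφφ, add_comm]
      · intro x hx
        rw [LinearMap.smul_apply, LinearMap.add_apply, LinearMap.id_apply, hφ, (hker x).1 hx,
          ← two_smul ℝ x, smul_smul]
        norm_num
    have htr := hproj.trace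
    rw [map_smul, map_add, LinearMap.trace_id, trace_mulLeftRight,
      re_eq_zero_of_sq_eq_neg_one_s11 hN, Quaternion.finrank_eq_four] at htr
    norm_num at htr
    exact_mod_cast htr.symm
  · refine (Set.eq_empty_or_nonempty _).imp_right ?_
    rintro ⟨x₀, hx₀ : T x₀ = H⟩
    refine ⟨x₀, hx₀, Set.ext fun x => ⟨fun (hx : T x = H) => ⟨x - x₀, ?_, ?_⟩, ?_⟩⟩
    · rw [SetLike.mem_coe, LinearMap.mem_ker, map_sub, hx, hx₀, sub_self]
    · exact add_sub_cancel x₀ x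
    · rintro ⟨y, hy, rfl⟩
      change T (x₀ + y) = H
      rw [map_add, LinearMap.mem_ker.1 hy, hx₀, add_zero]
end

section
/- Let S : ℍ² → ℍ² be a quaternionic linear map (linear for the right ℍ-module structure) with S ∘ S = −id. Then there exists a nonzero vector v ∈ ℍ² and a quaternion N with S v = v N; in particular, S maps the quaternionic line v·ℍ to itself, so the induced map on the quaternionic projective line ℍP¹ has a fixed point. -/
/-- A quaternionic linear map `S : ℍ² → ℍ²` (for the right scalar action) with
`S ∘ S = -id` has an eigenvector: there is `v ≠ 0` and `N ∈ ℍ` with `S v = v N`.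
In particular `S` maps the quaternionic line `v·ℍ` to itself, so the induced map on
`ℍP¹` has a fixed point. -/
theorem complex_structure_has_eigenline
    (S : (Fin 2 → Quaternion ℝ) → (Fin 2 → Quaternion ℝ))
    (hadd : ∀ u w, S (u + w) = S u + S w)
    (hsmul : ∀ u (lam : Quaternion ℝ), S (fun i => u i * lam) = fun i => S u i * lam)
    (hSS : ∀ u, S (S u) = -u) :
    ∃ (v : Fin 2 → Quaternion ℝ) (N : Quaternion ℝ), v ≠ 0 ∧
      (S v = fun i => v i * N) ∧
      (∀ lam : Quaternion ℝ, ∃ mu : Quaternion ℝ,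
        S (fun i => v i * lam) = fun i => v i * mu) := by
  suffices h : ∃ (v : Fin 2 → Quaternion ℝ) (N : Quaternion ℝ), v ≠ 0 ∧
      S v = fun i => v i * N by
    obtain ⟨v, N, hv, hN⟩ := h
    refine ⟨v, N, hv, hN, fun lam => ⟨N * lam, ?_⟩⟩
    simp only [hsmul, hN, mul_assoc]
  obtain ⟨I, hI⟩ : ∃ I : Quaternion ℝ, I * I = -1 :=
    ⟨Quaternion.ofComplex Complex.I, by rw [← map_mul, Complex.I_mul_I, map_neg, map_one]⟩
  obtain ⟨u, hu⟩ := exists_ne (0 : Fin 2 → Quaternion ℝ)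
  -- Either `S u + u I` is an eigenvector with eigenvalue `I`, or it vanishes and `S u = u (-I)`.
  by_cases hv : S u + (fun i => u i * I) = 0
  · refine ⟨u, -I, hu, ?_⟩
    rw [eq_neg_of_add_eq_zero_left hv]
    ext1 i
    simp
  · refine ⟨_, I, hv, ?_⟩
    rw [hadd, hSS, hsmul]
    ext1 i
    simp [add_mul, mul_assoc, hI, add_comm]
end

section
/- Let S : ℍ² → ℍ² be quaternionic linear with S ∘ S = −id, let (v, w) be a basis of ℍ² over ℍ, and suppose S v = v N and S w = −v H − w R for quaternions N, H, R. Then N² = −1 = R² and N H = H R; moreover, for every x ∈ ℍ, the vector v x + w spans an S-invariant quaternionic line (i.e. S(v x + w) ∈ (v x + w)·ℍ) if and only if N x + x R = H. -/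
/-- If `S : ℍ² → ℍ²` is quaternionic linear with `S² = -id`, `(v, w)` is a basis of
`ℍ²`, `S v = v N`, and `S w = -v H - w R`, then `N² = -1 = R²`, `N H = H R`, and for
every `x ∈ ℍ` the vector `v x + w` spans an `S`-invariant quaternionic line iff
`N x + x R = H`. -/
theorem invariant_lines_affine_equation
    (S : (Fin 2 → Quaternion ℝ) → (Fin 2 → Quaternion ℝ))
    (hadd : ∀ u u' : Fin 2 → Quaternion ℝ, S (u + u') = S u + S u')
    (hsmul : ∀ (u : Fin 2 → Quaternion ℝ) (lam : Quaternion ℝ),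
      S (fun i => u i * lam) = fun i => S u i * lam)
    (hSS : ∀ u, S (S u) = -u)
    (v w : Fin 2 → Quaternion ℝ)
    (hbasis : ∀ u : Fin 2 → Quaternion ℝ, ∃! p : Quaternion ℝ × Quaternion ℝ,
      u = fun i => v i * p.1 + w i * p.2)
    (N H R : Quaternion ℝ)
    (hSv : S v = fun i => v i * N)
    (hSw : S w = fun i => -(v i * H) - w i * R) :
    N ^ 2 = -1 ∧ R ^ 2 = -1 ∧ N * H = H * R ∧
    ∀ x : Quaternion ℝ,
      (∃ γ : Quaternion ℝ,
        S (fun i => v i * x + w i) = fun i => (v i * x + w i) * γ) ↔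
      N * x + x * R = H := by
  have coord : ∀ a b c d : Quaternion ℝ,
      (fun i => v i * a + w i * b) = (fun i => v i * c + w i * d) → a = c ∧ b = d := by
    intro a b c d h
    have := (hbasis fun i => v i * a + w i * b).unique (y₁ := (a, b)) (y₂ := (c, d)) rfl h
    exact Prod.mk.inj this
  have hS : ∀ a b : Quaternion ℝ, S (fun i => v i * a + w i * b) =
      fun i => v i * (N * a - H * b) + w i * -(R * b) := by
    intro a b
    have h := hadd (fun i => v i * a) (fun i => w i * b)
    rw [hsmul, hsmul, hSv, hSw] at h
    refine h.trans (funext fun i => ?_)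
    simp only [Pi.add_apply]
    noncomm_ring
  have hSS' : ∀ a b : Quaternion ℝ,
      N * (N * a - H * b) - H * -(R * b) = -a ∧ -(R * -(R * b)) = -b := by
    intro a b
    apply coord
    rw [← hS, ← hS, hSS]
    funext i
    simp only [Pi.neg_apply]
    noncomm_ring
  have hN := (hSS' 1 0).1
  obtain ⟨hH, hR⟩ := hSS' 0 1
  refine ⟨by simpa [sq] using hN, by simpa [sq] using hR, ?_, fun x => ?_⟩
  · exact (neg_add_eq_zero.mp (by simpa using hH))
  have hx : S (fun i => v i * x + w i) = fun i => v i * (N * x - H) + w i * -R := by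
    simpa using hS x 1
  rw [hx]
  have hγ : ∀ γ : Quaternion ℝ,
      (fun i => (v i * x + w i) * γ) = fun i => v i * (x * γ) + w i * γ := by
    intro γ
    funext i
    rw [add_mul, mul_assoc]
  constructor
  · rintro ⟨γ, h⟩
    rw [hγ] at h
    obtain ⟨h₁, rfl⟩ := coord _ _ _ _ h
    rw [mul_neg, sub_eq_iff_eq_add] at h₁
    rw [h₁]
    abel
  · rintro rfl
    refine ⟨-R, ?_⟩
    rw [hγ]
    funext i
    noncomm_ring
end

section
/- Let V be a finite-dimensional right quaternionic vector space, L ⊂ V a quaternionic line (1-dimensional ℍ-submodule), and let S, B be quaternionic linear endomorphisms of V with S ∘ S = −id, S ∘ B = −B ∘ S, and range B ⊆ L. Then the trace of B ∘ B, computed as an ℝ-linear endomorphism of the underlying real vector space, satisfies trace_ℝ(B²) ≤ 0, with equality if and only if B vanishes on L. -/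
/-- A quaternion anticommuting with a square root of `-1` is purely imaginary, so its square
is minus its squared norm. -/
theorem quaternion_mul_self_eq_of_anticommute {a b : Quaternion ℝ} (hb : b * b = -1)
    (hab : b * a = -(a * b)) : a * a = ((-Quaternion.normSq a : ℝ) : Quaternion ℝ) := by
  have hre : a.re = 0 := by
    have h1 : b * (a * b) = a := by
      rw [← mul_assoc, hab, neg_mul, mul_assoc, hb, mul_neg, mul_one, neg_neg]
    have h2 : (b * (a * b)).re = ((a * b) * b).re := by
      simp only [Quaternion.re_mul]; ring
    rw [h1, mul_assoc, hb, mul_neg, mul_one, Quaternion.re_neg] at h2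
    linarith
  have hstar : star a = -a := by
    ext <;> simp [hre]
  have h := Quaternion.self_mul_star a
  rw [hstar, mul_neg] at h
  rw [Quaternion.coe_neg, ← h, neg_neg]

/-- The trace of a nonzero endomorphism `C` with `C² = -c C` and `c > 0` is negative. -/
theorem trace_neg_of_comp_self_eq_neg_smul {V : Type*} [AddCommGroup V] [Module ℝ V]
    [FiniteDimensional ℝ V] {C : V →ₗ[ℝ] V} {c : ℝ} (hc : 0 < c) (hC : C ≠ 0)
    (hCC : ∀ x, C (C x) = -c • C x) : LinearMap.trace ℝ V C < 0 := by
  have hP : IsIdempotentElem (-c⁻¹ • C) := by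
    ext x
    simp only [Module.End.mul_apply, LinearMap.smul_apply, map_smul, hCC, smul_smul]
    congr 1
    field_simp
  have htr := (LinearMap.IsIdempotentElem.isProj_range _ hP).trace
  have hpos : 0 < Module.finrank ℝ (LinearMap.range (-c⁻¹ • C)) := by
    rw [Nat.pos_iff_ne_zero]
    intro h
    rw [Submodule.finrank_eq_zero, LinearMap.range_eq_bot, smul_eq_zero] at h
    exact h.elim (fun h => hc.ne' (by simpa using h)) hC
  have hpos' : (0 : ℝ) < Module.finrank ℝ (LinearMap.range (-c⁻¹ • C)) := by exact_mod_cast hpos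
  rw [← htr, map_smul, smul_eq_mul, neg_mul] at hpos'
  by_contra! h
  have := mul_nonneg (inv_pos.mpr hc).le h
  linarith


/-- Let `V` be a finite-dimensional right quaternionic vector space (a module over
`ℍᵐᵒᵖ`), `L ⊂ V` a quaternionic line, and `S, B` quaternionic endomorphisms with
`S² = -id`, `SB = -BS`, `range B ⊆ L`. Then the real trace of `B²` is `≤ 0`, with
equality iff `B` vanishes on `L`. -/
theorem trace_B_sq_nonpos {V : Type*} [AddCommGroup V]
    [Module (Quaternion ℝ)ᵐᵒᵖ V] [Module ℝ V]
    [IsScalarTower ℝ (Quaternion ℝ)ᵐᵒᵖ V] [FiniteDimensional ℝ V]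
    (L : Submodule (Quaternion ℝ)ᵐᵒᵖ V) (v₀ : V) (hv₀ : v₀ ≠ 0)
    (hL : L = Submodule.span (Quaternion ℝ)ᵐᵒᵖ {v₀})
    (S B : V →ₗ[(Quaternion ℝ)ᵐᵒᵖ] V)
    (hS : S ∘ₗ S = -LinearMap.id)
    (hSB : S ∘ₗ B = -(B ∘ₗ S))
    (hB : LinearMap.range B ≤ L) :
    LinearMap.trace ℝ V ((B ∘ₗ B).restrictScalars ℝ) ≤ 0 ∧
    (LinearMap.trace ℝ V ((B ∘ₗ B).restrictScalars ℝ) = 0 ↔ ∀ x ∈ L, B x = 0) := by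
  have hvL : v₀ ∈ L := hL ▸ Submodule.mem_span_singleton_self v₀
  have hmem : ∀ x, x ∈ L ↔ ∃ q : (Quaternion ℝ)ᵐᵒᵖ, q • v₀ = x := by
    intro x
    rw [hL, Submodule.mem_span_singleton]
  have hBL : ∀ x, B x ∈ L := fun x => hB ⟨x, rfl⟩
  have hzero : (∀ x ∈ L, B x = 0) →
      LinearMap.trace ℝ V ((B ∘ₗ B).restrictScalars ℝ) = 0 := by
    intro h
    have : (B ∘ₗ B).restrictScalars ℝ = 0 := by
      ext x
      exact h _ (hBL x)
    rw [this, map_zero]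
  by_cases hBv : B v₀ = 0
  · have h : ∀ x ∈ L, B x = 0 := by
      intro x hx
      obtain ⟨q, rfl⟩ := (hmem x).1 hx
      rw [map_smul, hBv, smul_zero]
    exact ⟨(hzero h).le, fun _ => h, hzero⟩
  have hneg : LinearMap.trace ℝ V ((B ∘ₗ B).restrictScalars ℝ) < 0 := by
    have hinj : ∀ p q : (Quaternion ℝ)ᵐᵒᵖ, p • v₀ = q • v₀ → p = q :=
      fun p q h => smul_left_injective _ hv₀ h
    obtain ⟨a, ha⟩ := (hmem _).1 (hBL v₀)
    have ha0 : a ≠ 0 := by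
      rintro rfl
      exact hBv (by rw [← ha, zero_smul])
    have hSB' : ∀ x, S (B x) = -B (S x) := fun x => LinearMap.congr_fun hSB x
    have hSv : S v₀ ∈ L := by
      have h : v₀ = B (a⁻¹ • v₀) := by
        rw [map_smul, ← ha, smul_smul, inv_mul_cancel₀ ha0, one_smul]
      rw [h, hSB']
      exact L.neg_mem (hBL _)
    obtain ⟨b, hb⟩ := (hmem _).1 hSv
    have hbb : b * b = -1 := by
      apply hinj
      have h : S (S v₀) = -v₀ := LinearMap.congr_fun hS v₀
      rw [← hb, map_smul, ← hb, smul_smul] at h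
      rw [h, neg_smul, one_smul]
    have hab : a * b = -(b * a) := by
      apply hinj
      have h := hSB' v₀
      rw [← ha, ← hb, map_smul, map_smul, ← ha, ← hb, smul_smul, smul_smul] at h
      rw [h, neg_smul]
    have hsq := quaternion_mul_self_eq_of_anticommute (a := a.unop) (b := b.unop)
      (by rw [← MulOpposite.unop_mul, hbb]; rfl)
      (by rw [← MulOpposite.unop_mul, hab]; rfl)
    set c : ℝ := Quaternion.normSq a.unop with hc
    have hcpos : 0 < c := by
      refine lt_of_le_of_ne Quaternion.normSq_nonneg (Ne.symm ?_)
      rw [hc, Ne, Quaternion.normSq_eq_zero, MulOpposite.unop_eq_zero_iff]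
      exact ha0
    have haa : a * a = (-c) • (1 : (Quaternion ℝ)ᵐᵒᵖ) := by
      apply MulOpposite.unop_injective
      rw [MulOpposite.unop_mul, hsq, MulOpposite.unop_smul, MulOpposite.unop_one,
        ← Quaternion.coe_one, ← Quaternion.coe_smul, smul_eq_mul, mul_one]
    have hBB : ∀ x ∈ L, B (B x) = (-c) • x := by
      intro x hx
      obtain ⟨q, rfl⟩ := (hmem x).1 hx
      rw [map_smul, map_smul, ← ha, map_smul, ← ha, smul_smul, smul_smul, mul_assoc, haa,
        mul_smul_comm, mul_one, smul_assoc]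
    refine trace_neg_of_comp_self_eq_neg_smul hcpos ?_ (fun x => hBB _ (hBL _))
    intro h
    have h0 : B (B v₀) = 0 := LinearMap.congr_fun h v₀
    rw [hBB v₀ hvL, smul_eq_zero] at h0
    exact h0.elim (fun h => hcpos.ne' (neg_eq_zero.1 h)) hv₀
  exact ⟨hneg.le, fun h => absurd h hneg.ne, hzero⟩
end

section
/- Let a, b, N, R, P be quaternions with N² = R² = P² = −1, N a = a R, N b = b R, and N(a + b) = P(a − b). Then a = 0 or b = 0. -/
/-- If `N² = R² = P² = -1`, `N a = a R`, `N b = b R`, and `N (a + b) = P (a - b)`,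
then `a = 0` or `b = 0`. -/
theorem superconformal_dichotomy (a b N R P : Quaternion ℝ)
    (hN : N ^ 2 = -1) (hR : R ^ 2 = -1) (hP : P ^ 2 = -1)
    (ha : N * a = a * R) (hb : N * b = b * R)
    (hab : N * (a + b) = P * (a - b)) :
    a = 0 ∨ b = 0 := by
  have : CharZero (Quaternion ℝ) := algebraRat.charZero _
  by_cases hb0 : b = 0
  · exact Or.inr hb0
  have hN0 : N ≠ 0 := by
    rintro rfl
    norm_num at hN
  have hsub : a - b ≠ 0 := by
    intro h
    rw [h, mul_zero, sub_eq_zero.mp h, ← two_mul] at hab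
    exact mul_ne_zero hN0 (mul_ne_zero two_ne_zero hb0) hab
  have hadd : N * (a + b) = (a + b) * R := by rw [mul_add, ha, hb, add_mul]
  -- `P = N (a + b) (a - b)⁻¹`, and both `a + b` and `a - b` intertwine `N` and `R`.
  have hNP : Commute N P := by
    refine mul_right_cancel₀ hsub ?_
    calc N * P * (a - b) = N * (N * (a + b)) := by rw [mul_assoc, hab]
      _ = N * (a + b) * R := by rw [mul_assoc, ← hadd]
      _ = P * (a - b) * R := by rw [hab]
      _ = P * N * (a - b) := by rw [mul_assoc, sub_mul, ← ha, ← hb, ← mul_sub, mul_assoc]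
  rcases hNP.sq_eq_sq_iff_eq_or_eq_neg.mp (hN.trans hP.symm) with h | h
  · rw [← h] at hab
    have hbb : a + b = a - b := mul_left_cancel₀ hN0 hab
    rw [sub_eq_add_neg, add_right_inj, self_eq_neg] at hbb
    exact Or.inr hbb
  · rw [← neg_eq_iff_eq_neg.mpr h, neg_mul, ← mul_neg] at hab
    have haa : a + b = -(a - b) := mul_left_cancel₀ hN0 hab
    rw [neg_sub, add_comm, sub_eq_add_neg, add_right_inj, self_eq_neg] at haa
    exact Or.inl haa
end
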